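/- arXiv:1606.06605 — 3 statements merged into one kernel-verified Lean document; each statement's English description precedes it below -/
import Mathlib

section
/- Let β ∈ ℝ⁴ be a timelike future-directed vector (η(β,β) > 0, β⁰ > 0) and let T = 1/√(η(β,β)) denote the proper temperature. For every unit timelike future-directed vector u (η(u,u) = 1, u⁰ > 0), the temperature marked by a thermometer moving with four-velocity u, namely T_T = 1/η(β,u), satisfies T_T ≤ T; moreover T_T = T if and only if u = β/√(η(β,β)). In other words, an ideal thermometer marks the maximal temperature precisely when it is comoving with the fluid. -/
/-- The Minkowski bilinear form on ℝ⁴. -/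
def eta (u v : Fin 4 → ℝ) : ℝ :=
  u 0 * v 0 - u 1 * v 1 - u 2 * v 2 - u 3 * v 3

theorem two_mul_time_mul_eta (u v : Fin 4 → ℝ) :
    2 * (u 0 * v 0) * eta u v = u 0 ^ 2 * eta v v + v 0 ^ 2 * eta u u +
      ((u 0 * v 1 - v 0 * u 1) ^ 2 + (u 0 * v 2 - v 0 * u 2) ^ 2 +
        (u 0 * v 3 - v 0 * u 3) ^ 2) := by
  unfold eta
  ring

theorem eta_smul_right (c : ℝ) (u v : Fin 4 → ℝ) : eta u (c • v) = c * eta u v := by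
  simp only [eta, Pi.smul_apply, smul_eq_mul]
  ring

/-- The reverse Cauchy–Schwarz inequality against a unit future-directed vector. -/
theorem sqrt_eta_self_le_eta {β u : Fin 4 → ℝ} (hβ : 0 ≤ eta β β) (hβ0 : 0 < β 0)
    (hu : eta u u = 1) (hu0 : 0 < u 0) : √(eta β β) ≤ eta β u := by
  have h := two_mul_time_mul_eta β u
  rw [hu] at h
  refine le_of_mul_le_mul_left ?_ (mul_pos two_pos (mul_pos hβ0 hu0))
  nlinarith [Real.sq_sqrt hβ, sq_nonneg (β 0 - u 0 * √(eta β β)),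
    sq_nonneg (β 0 * u 1 - u 0 * β 1), sq_nonneg (β 0 * u 2 - u 0 * β 2),
    sq_nonneg (β 0 * u 3 - u 0 * β 3)]

/-- The equality case of the reverse Cauchy–Schwarz inequality. -/
theorem eta_eq_sqrt_eta_self_iff {β u : Fin 4 → ℝ} (hβ : 0 < eta β β)
    (hu : eta u u = 1) (hu0 : 0 < u 0) :
    eta β u = √(eta β β) ↔ u = (√(eta β β))⁻¹ • β := by
  have hs : 0 < √(eta β β) := Real.sqrt_pos.2 hβ
  have hsq := Real.sq_sqrt hβ.le
  constructor
  · intro heq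
    have h := two_mul_time_mul_eta β u
    rw [hu, heq] at h
    have h0 : β 0 = u 0 * √(eta β β) := by
      refine sub_eq_zero.1 (pow_eq_zero_iff two_ne_zero |>.1 (le_antisymm ?_ (sq_nonneg _)))
      nlinarith [sq_nonneg (β 0 * u 1 - u 0 * β 1), sq_nonneg (β 0 * u 2 - u 0 * β 2),
        sq_nonneg (β 0 * u 3 - u 0 * β 3)]
    have hw : (β 0 * u 1 - u 0 * β 1) ^ 2 + (β 0 * u 2 - u 0 * β 2) ^ 2 +
        (β 0 * u 3 - u 0 * β 3) ^ 2 = 0 := by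
      have : (β 0 - u 0 * √(eta β β)) ^ 2 = 0 := by rw [sub_eq_zero.2 h0, sq, mul_zero]
      linear_combination u 0 ^ 2 * hsq - h - this
    have hcoord (i : Fin 4) (hi : β 0 * u i - u 0 * β i = 0) :
        u i = (√(eta β β))⁻¹ * β i := by
      rw [eq_inv_mul_iff_mul_eq₀ hs.ne']
      apply mul_left_cancel₀ hu0.ne'
      linear_combination hi - u i * h0
    ext i
    rw [Pi.smul_apply, smul_eq_mul]
    apply hcoord
    fin_cases i
    · exact sub_eq_zero.2 (mul_comm _ _)
    all_goals
      refine pow_eq_zero_iff two_ne_zero |>.1 (le_antisymm ?_ (sq_nonneg _))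
      simp only [Fin.mk_one, Fin.reduceFinMk]
      linarith [sq_nonneg (β 0 * u 1 - u 0 * β 1), sq_nonneg (β 0 * u 2 - u 0 * β 2),
        sq_nonneg (β 0 * u 3 - u 0 * β 3)]
  · intro h
    conv_lhs => rw [h]
    rw [eta_smul_right, inv_mul_eq_iff_eq_mul₀ hs.ne', ← sq, hsq]

/-- Let `β` be a timelike future-directed four-temperature vector, with proper
temperature `T = 1/√(η(β,β))`.  A thermometer moving with unit timelike
future-directed four-velocity `u` marks the temperature `T_T = 1/η(β,u)`.
Then `T_T ≤ T`, with equality if and only if the thermometer is comoving,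
`u = β/√(η(β,β))`. -/
theorem thermometer_temperature_le_proper_temperature
    (β : Fin 4 → ℝ) (hβ : eta β β > 0) (hβ0 : β 0 > 0) :
    ∀ u : Fin 4 → ℝ, eta u u = 1 → u 0 > 0 →
      1 / eta β u ≤ 1 / Real.sqrt (eta β β) ∧
      (1 / eta β u = 1 / Real.sqrt (eta β β) ↔
        u = (Real.sqrt (eta β β))⁻¹ • β) := by
  intro u hu hu0
  refine ⟨one_div_le_one_div_of_le (Real.sqrt_pos.2 hβ)
    (sqrt_eta_self_le_eta hβ.le hβ0 hu hu0), ?_⟩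
  rw [one_div, one_div, inv_inj]
  exact eta_eq_sqrt_eta_self_iff hβ hu hu0
end

section
/- Let β : ℝ⁴ → ℝ⁴ be twice continuously differentiable and suppose β satisfies the Killing equation for the Minkowski form: for every x, w, z ∈ ℝ⁴, η(Dβ(x)(w), z) + η(w, Dβ(x)(z)) = 0, where Dβ(x) is the (Fréchet) derivative of β at x. Then the second derivative of β vanishes identically: D²β(x) = 0 for all x; equivalently, the derivative Dβ(x) is a constant linear map independent of x. (This is the flat-spacetime case of the identity ∇_μ∇_ν β_λ = R^ρ_{μνλ} β_ρ for Killing fields.) -/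
theorem eta_comm (u v : Fin 4 → ℝ) : eta u v = eta v u := by
  unfold eta
  ring

theorem eq_zero_of_forall_eta_eq_zero {u : Fin 4 → ℝ} (h : ∀ z, eta u z = 0) : u = 0 := by
  ext i
  have hi := h (Pi.single i 1)
  fin_cases i <;> simpa [eta] using hi

theorem HasDerivAt.eta_const {f : ℝ → Fin 4 → ℝ} {f' : Fin 4 → ℝ} {t : ℝ}
    (hf : HasDerivAt f f' t) (z : Fin 4 → ℝ) :
    HasDerivAt (fun s => eta (f s) z) (eta f' z) t := by
  have h := hasDerivAt_pi.1 hf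
  exact ((((h 0).mul_const (z 0)).sub ((h 1).mul_const (z 1))).sub
    ((h 2).mul_const (z 2))).sub ((h 3).mul_const (z 3))

/-- Differentiating a field of `eta`-skew endomorphisms yields `eta`-skew endomorphisms. -/
theorem eta_skew_of_hasFDerivAt
    {A : (Fin 4 → ℝ) → (Fin 4 → ℝ) →L[ℝ] (Fin 4 → ℝ)}
    {A' : (Fin 4 → ℝ) →L[ℝ] (Fin 4 → ℝ) →L[ℝ] (Fin 4 → ℝ)} {x : Fin 4 → ℝ}
    (hA : HasFDerivAt A A' x) (hskew : ∀ x w z, eta (A x w) z + eta w (A x z) = 0)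
    (v w z : Fin 4 → ℝ) : eta (A' v w) z + eta w (A' v z) = 0 := by
  have hline (u : Fin 4 → ℝ) : HasDerivAt (fun t : ℝ => A (x + t • v) u) (A' v u) 0 :=
    (hA.hasLineDerivAt v).clm_apply (hasDerivAt_const (0 : ℝ) u) |>.congr_deriv (by simp)
  have h := ((hline w).eta_const z).add ((hline z).eta_const w)
  have hzero : ((fun t : ℝ => eta (A (x + t • v) w) z) + fun t : ℝ => eta (A (x + t • v) z) w) =
      fun _ => 0 := by
    funext t
    simpa [eta_comm w] using hskew (x + t • v) w z
  rw [hzero] at h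
  rw [eta_comm w]
  exact h.unique (hasDerivAt_const (0 : ℝ) (0 : ℝ))

/-- A bilinear map that is symmetric in its arguments and `eta`-skew in its second slot
vanishes. -/
theorem eq_zero_of_symm_of_eta_skew
    {B : (Fin 4 → ℝ) →L[ℝ] (Fin 4 → ℝ) →L[ℝ] (Fin 4 → ℝ)}
    (hsymm : ∀ v w, B v w = B w v) (hskew : ∀ v w z, eta (B v w) z + eta w (B v z) = 0) :
    B = 0 := by
  ext1 v
  ext1 w
  refine eq_zero_of_forall_eta_eq_zero fun z => ?_
  have h₁ := hskew v w z
  have h₂ := hskew z v w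
  have h₃ := hskew w z v
  rw [eta_comm w, hsymm v z] at h₁
  rw [eta_comm v, hsymm z w] at h₂
  rw [eta_comm z, hsymm w v] at h₃
  linarith

/-- A C² Killing field `β` of Minkowski spacetime (i.e. satisfying
`η(Dβ(x)(w), z) + η(w, Dβ(x)(z)) = 0` for all `x, w, z`) has vanishing
second derivative: `D²β(x) = 0` for all `x`; equivalently the derivative
`Dβ(x)` is a constant linear map.  This is the flat-spacetime case of
`∇_μ∇_ν β_λ = R^ρ_{μνλ} β_ρ`. -/
theorem killing_field_second_derivative_vanishes
    (β : (Fin 4 → ℝ) → (Fin 4 → ℝ))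
    (hβ : ContDiff ℝ 2 β)
    (hkill : ∀ x w z : Fin 4 → ℝ,
      eta (fderiv ℝ β x w) z + eta w (fderiv ℝ β x z) = 0) :
    (∀ x : Fin 4 → ℝ, fderiv ℝ (fun y => fderiv ℝ β y) x = 0) ∧
    (∀ x y : Fin 4 → ℝ, fderiv ℝ β x = fderiv ℝ β y) := by
  have hdiff : Differentiable ℝ (fderiv ℝ β) :=
    (hβ.fderiv_right (m := 1) (by norm_num)).differentiable one_ne_zero
  have hD (x : Fin 4 → ℝ) : fderiv ℝ (fderiv ℝ β) x = 0 :=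
    eq_zero_of_symm_of_eta_skew (hβ.contDiffAt.isSymmSndFDerivAt (by simp))
      (eta_skew_of_hasFDerivAt (hdiff x).hasFDerivAt hkill)
  exact ⟨hD, is_const_of_fderiv_eq_zero hdiff hD⟩
end

section
/- Let β : ℝ⁴ → ℝ⁴ be a twice continuously differentiable Killing field of Minkowski spacetime (η(Dβ(x)(w), z) + η(w, Dβ(x)(z)) = 0 for all x, w, z) and let ω : ℝ⁴ → (ℝ⁴ → ℝ) be a twice continuously differentiable one-form (covector field). Define the Lie derivative of ω along β by (L_β ω)(x)(v) = Dω(x)(β(x))(v) + ω(x)(Dβ(x)(v)), and the Lie derivative of the (0,2)-tensor field T(x)(u,v) = Dω(x)(u)(v) by (L_β T)(x)(u,v) = DT(x)(β(x))(u,v) + T(x)(Dβ(x)(u), v) + T(x)(u, Dβ(x)(v)). Then the Lie derivative along β commutes with differentiation: (L_β T)(x)(u,v) = D(L_β ω)(x)(u)(v) for all x, u, v ∈ ℝ⁴. (This is the flat-spacetime case of the Proposition that for a Killing field β, L_β(∇ω) = ∇(L_β ω).) -/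
theorem fderiv_fderiv_apply_comm {E F : Type*} [NormedAddCommGroup E] [NormedSpace ℝ E]
    [NormedAddCommGroup F] [NormedSpace ℝ F] {f : E → F} (hf : ContDiff ℝ 2 f) (x u v : E) :
    fderiv ℝ (fderiv ℝ f) x u v = fderiv ℝ (fderiv ℝ f) x v u :=
  (hf.contDiffAt.isSymmSndFDerivAt (by simp)).eq u v

theorem hasDerivAt_eta {f g : ℝ → Fin 4 → ℝ} {f' g' : Fin 4 → ℝ} {t : ℝ}
    (hf : HasDerivAt f f' t) (hg : HasDerivAt g g' t) :
    HasDerivAt (fun s => eta (f s) (g s)) (eta f' (g t) + eta (f t) g') t := by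
  have h i := (hasDerivAt_pi.1 hf i).mul (hasDerivAt_pi.1 hg i)
  refine ((((h 0).sub (h 1)).sub (h 2)).sub (h 3)).congr_deriv ?_
  simp only [eta]; ring

/-- The derivative of the Killing equation. -/
theorem eta_fderiv_fderiv_skew {β : (Fin 4 → ℝ) → (Fin 4 → ℝ)} (hβ : ContDiff ℝ 2 β)
    (hkill : ∀ x w z : Fin 4 → ℝ,
      eta (fderiv ℝ β x w) z + eta w (fderiv ℝ β x z) = 0) (x u w z : Fin 4 → ℝ) :
    eta (fderiv ℝ (fderiv ℝ β) x u w) z + eta w (fderiv ℝ (fderiv ℝ β) x u z) = 0 := by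
  have hB : HasFDerivAt (fderiv ℝ β) (fderiv ℝ (fderiv ℝ β) x) x :=
    ((hβ.fderiv_right (m := 1) (by norm_num)).differentiable (by norm_num) x).hasFDerivAt
  have hline : HasDerivAt (fun t : ℝ => fderiv ℝ β (x + t • u))
      (fderiv ℝ (fderiv ℝ β) x u) 0 := hB.hasLineDerivAt u
  have happ (a : Fin 4 → ℝ) : HasDerivAt (fun t : ℝ => fderiv ℝ β (x + t • u) a)
      (fderiv ℝ (fderiv ℝ β) x u a) 0 := by
    simpa using hline.clm_apply (hasDerivAt_const (0 : ℝ) a)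
  have h := (hasDerivAt_eta (happ w) (hasDerivAt_const (0 : ℝ) z)).add
    (hasDerivAt_eta (hasDerivAt_const (0 : ℝ) w) (happ z))
  have h0 := h.unique ((hasDerivAt_const (0 : ℝ) (0 : ℝ)).congr_of_eventuallyEq
    (.of_forall fun t => hkill (x + t • u) w z))
  simpa [eta] using h0

/-- Killing fields of Minkowski spacetime are affine. -/
theorem fderiv_fderiv_eq_zero_of_killing {β : (Fin 4 → ℝ) → (Fin 4 → ℝ)}
    (hβ : ContDiff ℝ 2 β) (hkill : ∀ x w z : Fin 4 → ℝ,
      eta (fderiv ℝ β x w) z + eta w (fderiv ℝ β x z) = 0) (x u v : Fin 4 → ℝ) :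
    fderiv ℝ (fderiv ℝ β) x u v = 0 := by
  refine eq_zero_of_forall_eta_eq_zero fun z => ?_
  have h₁ := eta_fderiv_fderiv_skew hβ hkill x u v z
  have h₂ := eta_fderiv_fderiv_skew hβ hkill x z u v
  have h₃ := eta_fderiv_fderiv_skew hβ hkill x v z u
  rw [eta_comm v, fderiv_fderiv_apply_comm hβ x u z] at h₁
  rw [eta_comm u, fderiv_fderiv_apply_comm hβ x z v] at h₂
  rw [eta_comm z, fderiv_fderiv_apply_comm hβ x v u] at h₃
  linarith

/-- For a C² Killing field `β` of Minkowski spacetime and a C² one-form `ω`,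
the Lie derivative along `β` commutes with differentiation: with
`T(x)(u,v) = Dω(x)(u)(v)`,
`(L_β T)(x)(u,v) = DT(x)(β(x))(u,v) + T(x)(Dβ(x)u, v) + T(x)(u, Dβ(x)v)`
equals `D(L_β ω)(x)(u)(v)`, where
`(L_β ω)(x)(v) = Dω(x)(β(x))(v) + ω(x)(Dβ(x)(v))`.
This is the flat-spacetime case of `L_β(∇ω) = ∇(L_β ω)` for Killing `β`. -/
theorem lie_derivative_commutes_with_derivative_one_form
    (β : (Fin 4 → ℝ) → (Fin 4 → ℝ))
    (ω : (Fin 4 → ℝ) → ((Fin 4 → ℝ) →L[ℝ] ℝ))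
    (hβ : ContDiff ℝ 2 β) (hω : ContDiff ℝ 2 ω)
    (hkill : ∀ x w z : Fin 4 → ℝ,
      eta (fderiv ℝ β x w) z + eta w (fderiv ℝ β x z) = 0) :
    ∀ x u v : Fin 4 → ℝ,
      fderiv ℝ (fun y => fderiv ℝ ω y) x (β x) u v
        + fderiv ℝ ω x (fderiv ℝ β x u) v
        + fderiv ℝ ω x u (fderiv ℝ β x v)
      = fderiv ℝ (fun y => fderiv ℝ ω y (β y) v + ω y (fderiv ℝ β y v)) x u := by
  intro x u v
  have hB : HasFDerivAt (fderiv ℝ β) (fderiv ℝ (fderiv ℝ β) x) x :=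
    ((hβ.fderiv_right (m := 1) (by norm_num)).differentiable (by norm_num) x).hasFDerivAt
  have hW : HasFDerivAt (fderiv ℝ ω) (fderiv ℝ (fderiv ℝ ω) x) x :=
    ((hω.fderiv_right (m := 1) (by norm_num)).differentiable (by norm_num) x).hasFDerivAt
  have hb : HasFDerivAt β (fderiv ℝ β x) x := (hβ.differentiable (by norm_num) x).hasFDerivAt
  have hw : HasFDerivAt ω (fderiv ℝ ω x) x := (hω.differentiable (by norm_num) x).hasFDerivAt
  have hv : HasFDerivAt (fun _ : Fin 4 → ℝ => v)
      (0 : (Fin 4 → ℝ) →L[ℝ] Fin 4 → ℝ) x := hasFDerivAt_const v x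
  have h := ((hW.clm_apply hb).clm_apply hv).add (hw.clm_apply (hB.clm_apply hv))
  have hR : fderiv ℝ (fun y => fderiv ℝ ω y (β y) v + ω y (fderiv ℝ β y v)) x = _ := h.fderiv
  rw [hR]
  simp only [add_apply, ContinuousLinearMap.comp_apply,
    ContinuousLinearMap.flip_apply, zero_apply, map_zero, zero_add,
    fderiv_fderiv_eq_zero_of_killing hβ hkill, fderiv_fderiv_apply_comm hω x (β x) u]
  ring
end
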